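/- arXiv:2011.13449 — 2 statements merged into one kernel-verified Lean document; each statement's English description precedes it below -/
import Mathlib

section
/- Let L_n denote the size of the largest block of a uniformly random non-crossing partition of [n] = {1, ..., n}. Then L_n/log₂ n → 1 in probability as n → ∞; that is, for every ε > 0, P(|L_n/log₂ n − 1| > ε) → 0 as n → ∞. -/
open Finset Filter

noncomputable section
open scoped Classical

/-- `P` is a non-crossing partition of `{1, …, n}`: a set partition such that there
are no `a < b < c < d` with `a, c` in one block and `b, d` in a different block. -/
def IsNCPartition (n : ℕ) (P : Finset (Finset ℕ)) : Prop :=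
  (∀ b ∈ P, b.Nonempty ∧ b ⊆ Finset.Icc 1 n) ∧
  (∀ x ∈ Finset.Icc 1 n, ∃! b, b ∈ P ∧ x ∈ b) ∧
  ¬ ∃ a b c d : ℕ, a < b ∧ b < c ∧ c < d ∧
      ∃ B ∈ P, ∃ B' ∈ P, B ≠ B' ∧ a ∈ B ∧ c ∈ B ∧ b ∈ B' ∧ d ∈ B'

/-- The finset of all non-crossing partitions of `{1, …, n}`. -/
def ncPartitions (n : ℕ) : Finset (Finset (Finset ℕ)) :=
  ((Finset.Icc 1 n).powerset.powerset).filter (fun P => IsNCPartition n P)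

/-- `P` is a non-crossing partition of the finite set `S` of natural numbers. -/
def IsNCPartitionOn (S : Finset ℕ) (P : Finset (Finset ℕ)) : Prop :=
  (∀ b ∈ P, b.Nonempty ∧ b ⊆ S) ∧
  (∀ x ∈ S, ∃! b, b ∈ P ∧ x ∈ b) ∧
  ¬ ∃ a b c d : ℕ, a < b ∧ b < c ∧ c < d ∧
      ∃ B ∈ P, ∃ B' ∈ P, B ≠ B' ∧ a ∈ B ∧ c ∈ B ∧ b ∈ B' ∧ d ∈ B'

/-- The function sending the minimum of each block of `P` to the size of that block, and every
other number to `0`. -/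
def blockWord (P : Finset (Finset ℕ)) (i : ℕ) : ℕ :=
  ∑ b ∈ P.filter (fun b : Finset ℕ => sInf (b : Set ℕ) = i), b.card

/-- The words arising as `blockWord` of a non-crossing partition of `S`. -/
def IsBallotWord (S : Finset ℕ) (x : ℕ → ℕ) : Prop :=
  (∀ i, i ∉ S → x i = 0) ∧ ∑ i ∈ S, x i = S.card ∧
    ∀ t, ∑ i ∈ S with t ≤ i, x i ≤ (S.filter (t ≤ ·)).card

lemma sInf_coe_mem {b : Finset ℕ} (hb : b.Nonempty) : sInf (b : Set ℕ) ∈ b :=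
  Finset.mem_coe.1 (Nat.sInf_mem (by simpa using hb))

lemma sInf_coe_le {b : Finset ℕ} {x : ℕ} (hx : x ∈ b) : sInf (b : Set ℕ) ≤ x :=
  Nat.sInf_le (by simpa using hx)

namespace IsNCPartitionOn

variable {S : Finset ℕ} {P Q : Finset (Finset ℕ)} {B C : Finset ℕ}

lemma eq_of_mem (h : IsNCPartitionOn S P) (hB : B ∈ P) (hC : C ∈ P) {x : ℕ}
    (hxB : x ∈ B) (hxC : x ∈ C) : B = C :=
  (h.2.1 x ((h.1 B hB).2 hxB)).unique ⟨hB, hxB⟩ ⟨hC, hxC⟩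

lemma pairwiseDisjoint (h : IsNCPartitionOn S P) :
    (P : Set (Finset ℕ)).PairwiseDisjoint id := by
  intro B hB C hC hne
  refine Finset.disjoint_left.2 fun x hxB hxC => hne (h.eq_of_mem hB hC hxB hxC)

lemma blockWord_sInf (h : IsNCPartitionOn S P) (hB : B ∈ P) :
    blockWord P (sInf (B : Set ℕ)) = B.card := by
  have : P.filter (fun b : Finset ℕ => sInf (b : Set ℕ) = sInf (B : Set ℕ)) = {B} := by
    ext C
    simp only [mem_filter, mem_singleton]
    constructor
    · rintro ⟨hC, hCB⟩
      exact h.eq_of_mem hC hB (sInf_coe_mem (h.1 C hC).1) (hCB ▸ sInf_coe_mem (h.1 B hB).1)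
    · rintro rfl
      exact ⟨hB, rfl⟩
  rw [blockWord, this, sum_singleton]

lemma blockWord_sInf_pos (h : IsNCPartitionOn S P) (hB : B ∈ P) :
    0 < blockWord P (sInf (B : Set ℕ)) := by
  rw [h.blockWord_sInf hB]
  exact (h.1 B hB).1.card_pos

lemma exists_of_blockWord_pos {i : ℕ} (hi : 0 < blockWord P i) :
    ∃ B ∈ P, sInf (B : Set ℕ) = i := by
  obtain ⟨B, hB, -⟩ := Finset.exists_ne_zero_of_sum_ne_zero hi.ne'
  exact ⟨B, (mem_filter.1 hB).1, (mem_filter.1 hB).2⟩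

lemma sum_filter_blockWord (h : IsNCPartitionOn S P) (t : ℕ) :
    ∑ i ∈ S with t ≤ i, blockWord P i =
      ((P.filter fun b : Finset ℕ => t ≤ sInf (b : Set ℕ)).biUnion id).card := by
  rw [card_biUnion]
  · have := sum_fiberwise_of_maps_to (s := P.filter fun b : Finset ℕ => t ≤ sInf (b : Set ℕ))
      (t := S.filter (t ≤ ·)) (g := fun b : Finset ℕ => sInf (b : Set ℕ)) (f := fun b : Finset ℕ => b.card) ?_
    · simp only [id]
      rw [← this]
      refine sum_congr rfl fun i hi => ?_
      rw [blockWord, filter_filter]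
      refine sum_congr (filter_congr fun b _ => ?_) fun _ _ => rfl
      have := (mem_filter.1 hi).2
      constructor
      · rintro rfl
        exact ⟨this, rfl⟩
      · exact fun h => h.2
    · intro b hb
      obtain ⟨hb, ht⟩ := mem_filter.1 hb
      exact mem_filter.2 ⟨(h.1 b hb).2 (sInf_coe_mem (h.1 b hb).1), ht⟩
  · intro B hB C hC hne
    exact h.pairwiseDisjoint (mem_filter.1 hB).1 (mem_filter.1 hC).1 hne

lemma isBallotWord (h : IsNCPartitionOn S P) : IsBallotWord S (blockWord P) := by
  refine ⟨fun i hi => ?_, ?_, fun t => ?_⟩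
  · by_contra h0
    obtain ⟨B, hB, rfl⟩ := exists_of_blockWord_pos (Nat.pos_of_ne_zero h0)
    exact hi ((h.1 B hB).2 (sInf_coe_mem (h.1 B hB).1))
  · have := h.sum_filter_blockWord 0
    simp only [zero_le, filter_true] at this
    rw [this]
    congr 1
    ext x
    simp only [mem_biUnion, id]
    constructor
    · rintro ⟨B, hB, hx⟩
      exact (h.1 B hB).2 hx
    · intro hx
      obtain ⟨B, hB, -⟩ := h.2.1 x hx
      exact ⟨B, hB⟩
  · rw [h.sum_filter_blockWord]
    refine card_le_card fun x hx => ?_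
    obtain ⟨B, hB, hx⟩ := mem_biUnion.1 hx
    obtain ⟨hB, ht⟩ := mem_filter.1 hB
    exact mem_filter.2 ⟨(h.1 B hB).2 hx, ht.trans (sInf_coe_le hx)⟩

/-- The block with the largest minimum is a segment of the ground set. -/
lemma mem_of_sInf_maximal (h : IsNCPartitionOn S P) (hB : B ∈ P)
    (hmax : ∀ C ∈ P, sInf (C : Set ℕ) ≤ sInf (B : Set ℕ)) {e b : ℕ} (he : e ∈ S)
    (hle : sInf (B : Set ℕ) ≤ e) (hb : b ∈ B) (heb : e ≤ b) : e ∈ B := by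
  by_contra heB
  obtain ⟨C, ⟨hC, heC⟩, -⟩ := h.2.1 e he
  have hne : C ≠ B := fun hCB => heB (hCB ▸ heC)
  have hBm := sInf_coe_mem (h.1 B hB).1
  have hCm := sInf_coe_mem (h.1 C hC).1
  have h1 : sInf (C : Set ℕ) < sInf (B : Set ℕ) :=
    lt_of_le_of_ne (hmax C hC) fun heq => hne (h.eq_of_mem hC hB hCm (heq ▸ hBm))
  have h2 : sInf (B : Set ℕ) < e := lt_of_le_of_ne hle fun heq => heB (heq ▸ hBm)
  have h3 : e < b := lt_of_le_of_ne heb fun heq => heB (heq ▸ hb)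
  exact h.2.2 ⟨_, _, _, _, h1, h2, h3, C, hC, B, hB, hne, hCm, heC, hBm, hb⟩

lemma erase (h : IsNCPartitionOn S P) (hB : B ∈ P) : IsNCPartitionOn (S \ B) (P.erase B) := by
  refine ⟨fun b hb => ⟨(h.1 b (mem_of_mem_erase hb)).1, fun x hx => Finset.mem_sdiff.2
    ⟨(h.1 b (mem_of_mem_erase hb)).2 hx, fun hxB => ?_⟩⟩, fun x hx => ?_, ?_⟩
  · exact (mem_erase.1 hb).1 (h.eq_of_mem (mem_of_mem_erase hb) hB hx hxB)
  · obtain ⟨hxS, hxB⟩ := Finset.mem_sdiff.1 hx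
    obtain ⟨C, ⟨hC, hxC⟩, hu⟩ := h.2.1 x hxS
    refine ⟨C, ⟨mem_erase.2 ⟨fun hCB => hxB (hCB ▸ hxC), hC⟩, hxC⟩, ?_⟩
    rintro D ⟨hD, hxD⟩
    exact hu D ⟨mem_of_mem_erase hD, hxD⟩
  · rintro ⟨a, b, c, d, hab, hbc, hcd, C, hC, D, hD, hrest⟩
    exact h.2.2 ⟨a, b, c, d, hab, hbc, hcd, C, mem_of_mem_erase hC, D, mem_of_mem_erase hD, hrest⟩

end IsNCPartitionOn

lemma blockWord_insert {P : Finset (Finset ℕ)} {B : Finset ℕ} (hB : B ∉ P) (i : ℕ) :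
    blockWord (insert B P) i = (if sInf (B : Set ℕ) = i then B.card else 0) + blockWord P i := by
  simp only [blockWord, sum_filter]
  rw [sum_insert hB]

/-- A non-crossing partition is determined by its block word. -/
theorem IsNCPartitionOn.eq_of_blockWord_eq {S : Finset ℕ} {P Q : Finset (Finset ℕ)}
    (hP : IsNCPartitionOn S P) (hQ : IsNCPartitionOn S Q) (hw : blockWord P = blockWord Q) :
    P = Q := by
  induction hm : P.card generalizing S P Q with
  | zero =>
    rw [card_eq_zero] at hm
    subst hm
    by_contra hne
    obtain ⟨B, hB⟩ := nonempty_iff_ne_empty.2 (Ne.symm hne)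
    have := hQ.blockWord_sInf_pos hB
    rw [← hw] at this
    simp [blockWord] at this
  | succ m ih =>
    obtain ⟨B, hB, hmax⟩ := exists_max_image P (fun b : Finset ℕ => sInf (b : Set ℕ))
      (card_pos.1 (by omega))
    obtain ⟨C, hC, hCB⟩ := IsNCPartitionOn.exists_of_blockWord_pos
      (hw ▸ hP.blockWord_sInf_pos hB)
    have hmax' : ∀ D ∈ Q, sInf (D : Set ℕ) ≤ sInf (C : Set ℕ) := by
      intro D hD
      obtain ⟨E, hE, hED⟩ := IsNCPartitionOn.exists_of_blockWord_pos
        (hw.symm ▸ hQ.blockWord_sInf_pos hD)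
      rw [← hED, hCB]
      exact hmax E hE
    have hcard : B.card = C.card := by
      rw [← hP.blockWord_sInf hB, ← hQ.blockWord_sInf hC, hCB, hw]
    have hBC : B = C := by
      by_cases hsub : B ⊆ C
      · exact eq_of_subset_of_card_le hsub hcard.ge
      · obtain ⟨b, hb, hbC⟩ := not_subset.1 hsub
        refine (eq_of_subset_of_card_le (fun c hc => ?_) hcard.le).symm
        refine hP.mem_of_sInf_maximal hB hmax ((hQ.1 C hC).2 hc) (hCB ▸ sInf_coe_le hc) hb ?_
        by_contra hlt
        exact hbC (hQ.mem_of_sInf_maximal hC hmax' ((hP.1 B hB).2 hb)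
          (hCB ▸ sInf_coe_le hb) hc (by omega))
    subst hBC
    have key : P.erase B = Q.erase B := by
      refine ih (hP.erase hB) (hQ.erase hC) ?_ (by rw [card_erase_of_mem hB, hm]; rfl)
      funext i
      have h1 := blockWord_insert (notMem_erase B P) i
      have h2 := blockWord_insert (notMem_erase B Q) i
      rw [insert_erase hB] at h1
      rw [insert_erase hC] at h2
      have := congrFun hw i
      omega
    rw [← insert_erase hB, key, insert_erase hC]

lemma exists_initial_segment (T : Finset ℕ) {k : ℕ} (hk : k ≤ T.card) :
    ∃ B ⊆ T, B.card = k ∧ ∀ e ∈ T, ∀ b ∈ B, e ≤ b → e ∈ B := by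
  induction k with
  | zero => exact ⟨∅, by simp⟩
  | succ k ih =>
    obtain ⟨B, hBT, hBk, hB⟩ := ih (by omega)
    have hne : (T \ B).Nonempty := by
      rw [← card_pos, card_sdiff_of_subset hBT]
      omega
    have hm := Finset.mem_sdiff.1 (sInf_coe_mem hne)
    refine ⟨insert (sInf ((T \ B : Finset ℕ) : Set ℕ)) B, ?_, ?_, ?_⟩
    · exact insert_subset hm.1 hBT
    · rw [card_insert_of_notMem hm.2, hBk]
    · intro e he b hb heb
      by_cases heB : e ∈ B
      · exact mem_insert_of_mem heB
      · obtain rfl | hb := mem_insert.1 hb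
        · have := sInf_coe_le (Finset.mem_sdiff.2 ⟨he, heB⟩)
          rw [le_antisymm heb this]
          exact mem_insert_self _ _
        · exact absurd (hB e he b hb heb) heB

lemma IsNCPartitionOn.insert {S B : Finset ℕ} {P : Finset (Finset ℕ)}
    (hP : IsNCPartitionOn (S \ B) P) (hBS : B ⊆ S) (hB : B.Nonempty)
    (hseg : ∀ e ∈ S, ∀ a ∈ B, ∀ b ∈ B, a ≤ e → e ≤ b → e ∈ B) :
    IsNCPartitionOn S (insert B P) := by
  refine ⟨?_, ?_, ?_⟩
  · intro b hb
    obtain rfl | hb := mem_insert.1 hb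
    · exact ⟨hB, hBS⟩
    · exact ⟨(hP.1 b hb).1, (hP.1 b hb).2.trans sdiff_subset⟩
  · intro x hx
    by_cases hxB : x ∈ B
    · refine ⟨B, ⟨mem_insert_self _ _, hxB⟩, ?_⟩
      rintro C ⟨hC, hxC⟩
      obtain rfl | hC := mem_insert.1 hC
      · rfl
      · exact absurd hxB (Finset.mem_sdiff.1 ((hP.1 C hC).2 hxC)).2
    · obtain ⟨C, ⟨hC, hxC⟩, hu⟩ := hP.2.1 x (Finset.mem_sdiff.2 ⟨hx, hxB⟩)
      refine ⟨C, ⟨mem_insert_of_mem hC, hxC⟩, ?_⟩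
      rintro D ⟨hD, hxD⟩
      obtain rfl | hD := mem_insert.1 hD
      · exact absurd hxD hxB
      · exact hu D ⟨hD, hxD⟩
  · rintro ⟨a, b, c, d, hab, hbc, hcd, C, hC, D, hD, hne, haC, hcC, hbD, hdD⟩
    rw [mem_insert] at hC hD
    by_cases hCB : C = B
    · have hD' := hD.resolve_left fun h => hne (hCB.trans h.symm)
      have := Finset.mem_sdiff.1 ((hP.1 D hD').2 hbD)
      exact this.2 (hseg b this.1 a (hCB ▸ haC) c (hCB ▸ hcC) hab.le hbc.le)
    · have hC' := hC.resolve_left hCB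
      obtain hDB | hD' := hD
      · have := Finset.mem_sdiff.1 ((hP.1 C hC').2 hcC)
        exact this.2 (hseg c this.1 b (hDB ▸ hbD) d (hDB ▸ hdD) hbc.le hcd.le)
      · exact hP.2.2 ⟨a, b, c, d, hab, hbc, hcd, C, hC', D, hD', hne, haC, hcC, hbD, hdD⟩

/-- Every ballot word is the block word of a non-crossing partition. -/
theorem IsBallotWord.exists_blockWord_eq {S : Finset ℕ} {x : ℕ → ℕ} (hx : IsBallotWord S x) :
    ∃ P, IsNCPartitionOn S P ∧ blockWord P = x := by
  induction hm : S.card using Nat.strong_induction_on generalizing S x with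
  | _ m ih =>
  obtain ⟨hx0, hxS, hxt⟩ := hx
  obtain rfl | hS := S.eq_empty_or_nonempty
  · refine ⟨∅, ⟨by simp, by simp, by simp⟩, ?_⟩
    funext i
    simp [blockWord, hx0]
  have hne : (S.filter (0 < x ·)).Nonempty := by
    obtain ⟨i, hi, h0⟩ := exists_ne_zero_of_sum_ne_zero (hxS.trans_ne hS.card_pos.ne')
    exact ⟨i, mem_filter.2 ⟨hi, Nat.pos_of_ne_zero h0⟩⟩
  obtain ⟨i, hi, himax⟩ := exists_max_image _ id hne
  obtain ⟨hiS, hxi⟩ := mem_filter.1 hi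
  have hzero : ∀ j, i < j → x j = 0 := by
    intro j hj
    by_cases hjS : j ∈ S
    · by_contra h0
      have := himax j (mem_filter.2 ⟨hjS, Nat.pos_of_ne_zero h0⟩)
      simp only [id] at this
      omega
    · exact hx0 j hjS
  have hle : x i ≤ (S.filter (i ≤ ·)).card :=
    (single_le_sum (f := x) (fun _ _ => Nat.zero_le _)
      (mem_filter.2 ⟨hiS, le_rfl⟩)).trans (hxt i)
  obtain ⟨B, hBT, hBcard, hBseg⟩ := exists_initial_segment _ hle
  have hBne : B.Nonempty := card_pos.1 (by omega)
  have hBS : B ⊆ S := hBT.trans (filter_subset _ _)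
  have hBi : ∀ b ∈ B, i ≤ b := fun b hb => (mem_filter.1 (hBT hb)).2
  have hiB : i ∈ B := by
    obtain ⟨b, hb⟩ := hBne
    exact hBseg i (mem_filter.2 ⟨hiS, le_rfl⟩) b hb (hBi b hb)
  have hBinf : sInf (B : Set ℕ) = i :=
    le_antisymm (sInf_coe_le hiB) (hBi _ (sInf_coe_mem hBne))
  have hx'B : ∀ j ∈ B, Function.update x i 0 j = 0 := by
    intro j hj
    by_cases hji : j = i
    · simp [hji]
    · rw [Function.update_of_ne hji]
      exact hzero j (lt_of_le_of_ne (hBi j hj) (Ne.symm hji))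
  have hcardS : (S \ B).card + B.card = S.card := by
    rw [card_sdiff_of_subset hBS]
    have := card_le_card hBS
    omega
  have hsum : ∀ T : Finset ℕ, i ∈ T → B ⊆ T →
      ∑ j ∈ T \ B, Function.update x i 0 j + x i = ∑ j ∈ T, x j := by
    intro T hiT hBT
    have h1 := sum_sdiff (f := Function.update x i 0) hBT
    rw [sum_eq_zero hx'B, add_zero] at h1
    rw [h1, sum_update_of_mem hiT, zero_add, ← erase_eq, sum_erase_add _ _ hiT]
  have hbal : IsBallotWord (S \ B) (Function.update x i 0) := by
    refine ⟨fun j hj => ?_, ?_, fun t => ?_⟩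
    · by_cases hjB : j ∈ B
      · exact hx'B j hjB
      · have hjS : j ∉ S := fun h => hj (Finset.mem_sdiff.2 ⟨h, hjB⟩)
        rw [Function.update_of_ne (by rintro rfl; exact hjS hiS)]
        exact hx0 j hjS
    · have := hsum S hiS hBS
      omega
    · by_cases ht : t ≤ i
      · have hBT' : B ⊆ S.filter (t ≤ ·) := fun b hb =>
          mem_filter.2 ⟨hBS hb, ht.trans (hBi b hb)⟩
        have heq : (S \ B).filter (t ≤ ·) = S.filter (t ≤ ·) \ B := by
          ext j
          simp only [mem_filter, Finset.mem_sdiff]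
          tauto
        have h1 : _ = ∑ j ∈ S with t ≤ j, x j := hsum _ (mem_filter.2 ⟨hiS, ht⟩) hBT'
        have h2 := hxt t
        have h3 := card_le_card hBT'
        rw [heq, card_sdiff_of_subset hBT']
        omega
      · rw [sum_eq_zero]
        · exact Nat.zero_le _
        · intro j hj
          have := (mem_filter.1 hj).2
          rw [Function.update_of_ne (by omega)]
          exact hzero j (by omega)
  obtain ⟨P, hP, hPw⟩ := ih _ (by omega) hbal rfl
  have hBP : B ∉ P := fun h => (Finset.mem_sdiff.1 ((hP.1 B h).2 hiB)).2 hiB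
  refine ⟨insert B P, hP.insert hBS hBne ?_, ?_⟩
  · intro e he a ha b hb hae heb
    exact hBseg e (mem_filter.2 ⟨he, (hBi a ha).trans hae⟩) b hb heb
  · funext j
    rw [blockWord_insert hBP, hPw, hBinf]
    by_cases hj : i = j
    · subst hj
      simp [hBcard]
    · rw [if_neg hj, Function.update_of_ne (Ne.symm hj), zero_add]

lemma isBallotWord_Icc_iff {n : ℕ} {x : ℕ → ℕ} :
    IsBallotWord (Icc 1 n) x ↔ (∀ i, i ∉ Icc 1 n → x i = 0) ∧ ∑ i ∈ range n, x (i + 1) = n ∧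
      ∀ t ≤ n, t ≤ ∑ i ∈ range t, x (i + 1) := by
  have hfilter : ∀ t, (Icc 1 n).filter (t + 1 ≤ ·) = Ico (t + 1) (n + 1) := by
    intro t
    ext j
    simp only [mem_filter, mem_Icc, mem_Ico]
    omega
  have hsum : ∀ t ≤ n, ∑ i ∈ range t, x (i + 1) + ∑ i ∈ (Icc 1 n).filter (t + 1 ≤ ·), x i =
      ∑ i ∈ range n, x (i + 1) := by
    intro t ht
    rw [hfilter, ← sum_Ico_add' x t n 1, range_eq_Ico, range_eq_Ico,
      sum_Ico_consecutive _ (Nat.zero_le t) ht]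
  have hall : (Icc 1 n).filter (0 + 1 ≤ ·) = Icc 1 n := by
    ext j
    simp only [mem_filter, mem_Icc]
    omega
  have hall' : (Icc 1 n).filter (0 ≤ ·) = Icc 1 n := by simp
  have htotal := hsum 0 (Nat.zero_le n)
  rw [hall, range_zero, sum_empty, zero_add] at htotal
  unfold IsBallotWord
  rw [htotal, Nat.card_Icc, Nat.add_sub_cancel]
  refine and_congr_right fun _ => and_congr_right fun hn => ⟨fun h t ht => ?_, fun h t => ?_⟩
  · have h1 := h (t + 1)
    have h2 := hsum t ht
    have h3 : ((Icc 1 n).filter (t + 1 ≤ ·)).card = n - t := by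
      rw [hfilter, Nat.card_Ico]
      omega
    omega
  · obtain _ | t := t
    · rw [hall', htotal, Nat.card_Icc]
      omega
    · have h3 : ((Icc 1 n).filter (t + 1 ≤ ·)).card = n - t := by
        rw [hfilter, Nat.card_Ico]
        omega
      by_cases ht : t ≤ n
      · have h1 := h t ht
        have h2 := hsum t ht
        omega
      · rw [hfilter, Ico_eq_empty (by omega)]
        simp

/-- A cyclic word `y` whose partial sums, read from `0`, never fall behind the number of letters
read, except possibly at the last letter. -/
def IsDominating {n : ℕ} (y : ZMod (n + 1) → ℕ) : Prop :=
  ∀ t ≤ n, t ≤ ∑ i ∈ range t, y (i : ZMod (n + 1))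

lemma sum_range_natCast_zmod {n : ℕ} (y : ZMod (n + 1) → ℕ) :
    ∑ i ∈ range (n + 1), y (i : ZMod (n + 1)) = ∑ a, y a := by
  refine sum_nbij' (fun i => (i : ZMod (n + 1))) (fun a => a.val) ?_ ?_ ?_ ?_ ?_
  · simp
  · intro a _
    exact mem_range.2 (ZMod.val_lt a)
  · intro i hi
    exact ZMod.val_cast_of_lt (mem_range.1 hi)
  · simp
  · simp

lemma sum_range_add_zmod {n : ℕ} (y : ZMod (n + 1) → ℕ) (r t : ℕ) :
    ∑ i ∈ range (r + t), y (i : ZMod (n + 1)) =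
      ∑ i ∈ range r, y (i : ZMod (n + 1)) +
        ∑ i ∈ range t, y ((i : ZMod (n + 1)) + (r : ZMod (n + 1))) := by
  rw [sum_range_add]
  congr 1
  refine sum_congr rfl fun i _ => ?_
  push_cast
  rw [add_comm]

/-- The cycle lemma: exactly one rotation of a cyclic word of length `n + 1` with sum `n` is
dominating. -/
theorem existsUnique_isDominating_rotation {n : ℕ} {y : ZMod (n + 1) → ℕ} (hy : ∑ a, y a = n) :
    ∃! r : ZMod (n + 1), IsDominating fun a => y (a + r) := by
  set s : ℕ → ℕ := fun t => ∑ i ∈ range t, y (i : ZMod (n + 1)) with hs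
  have hperiod : ∀ t, s (n + 1 + t) = n + s t := by
    intro t
    simp only [hs]
    rw [sum_range_add_zmod, sum_range_natCast_zmod, hy]
    congr 1
    refine sum_congr rfl fun i _ => ?_
    rw [ZMod.natCast_self, add_zero]
  have hiff : ∀ r : ℕ, (IsDominating fun a => y (a + (r : ZMod (n + 1)))) ↔
      ∀ t ≤ n, s r + t ≤ s (r + t) := by
    intro r
    refine forall₂_congr fun t _ => ?_
    simp only [hs]
    rw [sum_range_add_zmod]
    omega
  have hmin : ∃ r, r ≤ n ∧ ∀ t ≤ n, s r + t ≤ s t + r := by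
    obtain ⟨r, hr, hle⟩ := exists_min_image (range (n + 1)) (fun t => (s t : ℤ) - t) ⟨0, by simp⟩
    refine ⟨r, by simpa [Nat.lt_succ_iff] using hr, fun t ht => ?_⟩
    have := hle t (mem_range.2 (by omega))
    omega
  obtain ⟨hr, hle⟩ := Nat.find_spec hmin
  have hlt : ∀ t < Nat.find hmin, s (Nat.find hmin) + t < s t + Nat.find hmin := by
    intro t ht
    by_contra hcon
    refine Nat.find_min hmin ht ⟨by omega, fun t' ht' => ?_⟩
    have := hle t' ht'
    omega
  refine ⟨(Nat.find hmin : ZMod (n + 1)), (hiff _).2 fun t ht => ?_, fun r' hr' => ?_⟩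
  · by_cases h : Nat.find hmin + t ≤ n
    · have := hle _ h
      omega
    · have h1 := hlt (Nat.find hmin + t - (n + 1)) (by omega)
      have h2 := hperiod (Nat.find hmin + t - (n + 1))
      rw [show n + 1 + (Nat.find hmin + t - (n + 1)) = Nat.find hmin + t by omega] at h2
      omega
  · have hr'lt := ZMod.val_lt r'
    rw [← ZMod.natCast_zmod_val r', hiff] at hr'
    rw [← ZMod.natCast_zmod_val r']
    congr 1
    obtain h | h | h := lt_trichotomy r'.val (Nat.find hmin)
    · have h1 := hr' (Nat.find hmin - r'.val) (by omega)
      rw [Nat.add_sub_cancel' h.le] at h1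
      have := hlt _ h
      omega
    · exact h
    · have h1 := hr' (n + 1 + Nat.find hmin - r'.val) (by omega)
      rw [show r'.val + (n + 1 + Nat.find hmin - r'.val) = n + 1 + Nat.find hmin by omega,
        hperiod] at h1
      have := hle r'.val (by omega)
      omega

lemma card_filter_rotation {n : ℕ} {p : (ZMod (n + 1) → ℕ) → Prop}
    (hp : ∀ y r, p (fun a => y (a + r)) ↔ p y) :
    (n + 1) * ((piAntidiag univ n).filter fun y : ZMod (n + 1) → ℕ => p y ∧ IsDominating y).card =
      ((piAntidiag univ n).filter fun y : ZMod (n + 1) → ℕ => p y).card := by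
  have hrot : ∀ (y : ZMod (n + 1) → ℕ) (r : ZMod (n + 1)), ∑ a, y (a + r) = ∑ a, y a :=
    fun y r => Equiv.sum_comp (Equiv.addRight r) y
  have hdouble := sum_card_bipartiteAbove_eq_sum_card_bipartiteBelow
    (s := (univ : Finset (ZMod (n + 1))))
    (t := (piAntidiag univ n).filter fun y : ZMod (n + 1) → ℕ => p y)
    (fun r y => IsDominating fun a => y (a + r))
  have hright : ∀ y ∈ (piAntidiag univ n).filter (fun y : ZMod (n + 1) → ℕ => p y),
      (bipartiteBelow (fun r y => IsDominating fun a => y (a + r))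
        (univ : Finset (ZMod (n + 1))) y).card = 1 := by
    intro y hy
    obtain ⟨r, hr, hu⟩ := existsUnique_isDominating_rotation
      (mem_piAntidiag.1 (mem_filter.1 hy).1).1
    refine card_eq_one.2 ⟨r, ?_⟩
    ext r'
    simp only [bipartiteBelow, mem_filter, mem_univ, true_and, mem_singleton]
    exact ⟨hu r', fun h => h ▸ hr⟩
  have hleft : ∀ r ∈ (univ : Finset (ZMod (n + 1))),
      (bipartiteAbove (fun r y => IsDominating fun a => y (a + r))
        ((piAntidiag univ n).filter fun y : ZMod (n + 1) → ℕ => p y) r).card =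
      ((piAntidiag univ n).filter fun y : ZMod (n + 1) → ℕ => p y ∧ IsDominating y).card := by
    intro r _
    refine card_nbij' (fun y a => y (a + r)) (fun y a => y (a + -r)) ?_ ?_ ?_ ?_
    · intro y hy
      simp only [bipartiteAbove, coe_filter, mem_filter, mem_piAntidiag, mem_univ,
        implies_true, and_true, Set.mem_ofPred_eq] at hy ⊢
      exact ⟨(hrot y r).trans hy.1.1, (hp y r).2 hy.1.2, hy.2⟩
    · intro y hy
      simp only [bipartiteAbove, coe_filter, mem_filter, mem_piAntidiag, mem_univ,
        implies_true, and_true, Set.mem_ofPred_eq] at hy ⊢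
      refine ⟨⟨(hrot y (-r)).trans hy.1, (hp y (-r)).2 hy.2.1⟩, ?_⟩
      simpa using hy.2.2
    · intro y _
      simp
    · intro y _
      simp
  rw [sum_congr rfl hright, sum_congr rfl hleft] at hdouble
  simpa [ZMod.card] using hdouble

/-- The block word of a partition of `{1, …, n}` as a cyclic word of length `n + 1`. -/
def cyclicBlockWord (n : ℕ) (P : Finset (Finset ℕ)) (a : ZMod (n + 1)) : ℕ :=
  blockWord P (a.val + 1)

lemma IsBallotWord.cyclic {n : ℕ} {x : ℕ → ℕ} (hx : IsBallotWord (Icc 1 n) x) :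
    ∑ a : ZMod (n + 1), x (a.val + 1) = n ∧
      IsDominating fun a : ZMod (n + 1) => x (a.val + 1) := by
  obtain ⟨hx0, hxn, hxt⟩ := isBallotWord_Icc_iff.1 hx
  have hval : ∀ t ≤ n + 1, ∑ i ∈ range t, x ((i : ZMod (n + 1)).val + 1) =
      ∑ i ∈ range t, x (i + 1) := by
    intro t ht
    refine sum_congr rfl fun i hi => ?_
    rw [ZMod.val_cast_of_lt ((mem_range.1 hi).trans_le ht)]
  refine ⟨?_, fun t ht => ?_⟩
  · rw [← sum_range_natCast_zmod, hval _ le_rfl, sum_range_succ, hxn, hx0 (n + 1) (by simp)]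
    rfl
  · rw [hval t (by omega)]
    exact hxt t ht

lemma IsDominating.exists_isBallotWord {n : ℕ} {y : ZMod (n + 1) → ℕ} (hy : IsDominating y)
    (hsum : ∑ a, y a = n) :
    ∃ x, IsBallotWord (Icc 1 n) x ∧ ∀ a : ZMod (n + 1), x (a.val + 1) = y a := by
  set x : ℕ → ℕ := fun i => if i ∈ Icc 1 n then y ((i - 1 : ℕ) : ZMod (n + 1)) else 0 with hxdef
  have hxy : ∀ i < n, x (i + 1) = y (i : ZMod (n + 1)) := by
    intro i hi
    simp only [hxdef]
    rw [if_pos (mem_Icc.2 (by omega)), Nat.add_sub_cancel]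
  have hx0 : ∀ i, i ∉ Icc 1 n → x i = 0 := fun i hi => if_neg hi
  have hpart : ∀ t ≤ n, ∑ i ∈ range t, x (i + 1) = ∑ i ∈ range t, y (i : ZMod (n + 1)) :=
    fun t ht => sum_congr rfl fun i hi => hxy i ((mem_range.1 hi).trans_le ht)
  have hn := hy n le_rfl
  rw [← sum_range_natCast_zmod, sum_range_succ] at hsum
  refine ⟨x, isBallotWord_Icc_iff.2 ⟨hx0, ?_, fun t ht => ?_⟩, fun a => ?_⟩
  · rw [hpart n le_rfl]
    omega
  · rw [hpart t ht]
    exact hy t ht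
  · have ha := ZMod.val_lt a
    by_cases h : a.val < n
    · rw [hxy _ h, ZMod.natCast_zmod_val]
    · rw [hx0 _ (by simp only [mem_Icc]; omega), ← ZMod.natCast_zmod_val a,
        show a.val = n by omega]
      omega

lemma IsNCPartitionOn.sup_card_eq {n : ℕ} {P : Finset (Finset ℕ)}
    (h : IsNCPartitionOn (Icc 1 n) P) : P.sup card = univ.sup (cyclicBlockWord n P) := by
  refine le_antisymm (Finset.sup_le fun B hB => ?_) (Finset.sup_le fun a _ => ?_)
  · have hmem := mem_Icc.1 ((h.1 B hB).2 (sInf_coe_mem (h.1 B hB).1))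
    have : cyclicBlockWord n P ((sInf (B : Set ℕ) - 1 : ℕ) : ZMod (n + 1)) = B.card := by
      rw [cyclicBlockWord, ZMod.val_cast_of_lt (by omega), Nat.sub_add_cancel hmem.1,
        h.blockWord_sInf hB]
    rw [← this]
    exact le_sup (f := cyclicBlockWord n P) (mem_univ _)
  · obtain h0 | h0 := Nat.eq_zero_or_pos (cyclicBlockWord n P a)
    · rw [h0]
      exact Nat.zero_le _
    · obtain ⟨B, hB, hBa⟩ := IsNCPartitionOn.exists_of_blockWord_pos h0
      rw [cyclicBlockWord, ← hBa, h.blockWord_sInf hB]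
      exact le_sup (f := card) hB

lemma mem_ncPartitions_iff {n : ℕ} {P : Finset (Finset ℕ)} :
    P ∈ ncPartitions n ↔ IsNCPartitionOn (Icc 1 n) P := by
  rw [ncPartitions, mem_filter]
  refine ⟨fun h => h.2, fun h => ⟨?_, h⟩⟩
  exact mem_powerset.2 fun B hB => mem_powerset.2 (h.1 B hB).2

/-- The largest block of a uniform non-crossing partition is distributed like the largest part of
a uniform weak composition of `n` into `n + 1` parts. -/
theorem card_filter_ncPartitions (n : ℕ) (p : ℕ → Prop) :
    (n + 1) * ((ncPartitions n).filter fun P => p (P.sup card)).card =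
      ((piAntidiag univ n).filter fun y : ZMod (n + 1) → ℕ => p (univ.sup y)).card := by
  rw [← card_filter_rotation]
  · congr 1
    refine card_bij (fun P _ => cyclicBlockWord n P) ?_ ?_ ?_
    · intro P hP
      obtain ⟨hP, hp⟩ := mem_filter.1 hP
      rw [mem_ncPartitions_iff] at hP
      have hc := hP.isBallotWord.cyclic
      rw [hP.sup_card_eq] at hp
      exact mem_filter.2 ⟨mem_piAntidiag.2 ⟨hc.1, fun _ _ => mem_univ _⟩, hp, hc.2⟩
    · intro P hP Q hQ hPQ
      have hP := mem_ncPartitions_iff.1 (mem_filter.1 hP).1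
      have hQ := mem_ncPartitions_iff.1 (mem_filter.1 hQ).1
      refine hP.eq_of_blockWord_eq hQ (funext fun i => ?_)
      by_cases hi : i ∈ Icc 1 n
      · rw [mem_Icc] at hi
        have := congrFun hPQ ((i - 1 : ℕ) : ZMod (n + 1))
        rwa [cyclicBlockWord, cyclicBlockWord, ZMod.val_cast_of_lt (by omega),
          Nat.sub_add_cancel hi.1] at this
      · rw [hP.isBallotWord.1 i hi, hQ.isBallotWord.1 i hi]
    · intro y hy
      obtain ⟨hy, hp, hdom⟩ := mem_filter.1 hy
      obtain ⟨x, hx, hxy⟩ := hdom.exists_isBallotWord (mem_piAntidiag.1 hy).1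
      obtain ⟨P, hP, rfl⟩ := hx.exists_blockWord_eq
      have hPy : cyclicBlockWord n P = y := funext hxy
      refine ⟨P, mem_filter.2 ⟨mem_ncPartitions_iff.2 hP, ?_⟩, hPy⟩
      rwa [hP.sup_card_eq, hPy]
  · intro y r
    have : univ.sup (fun a => y (a + r)) = univ.sup y := by
      refine le_antisymm (Finset.sup_le fun a _ => le_sup (f := y) (mem_univ _))
        (Finset.sup_le fun a _ => ?_)
      have := le_sup (f := fun a => y (a + r)) (mem_univ (a - r))
      simpa using this
    rw [this]

lemma card_piAntidiag_univ_zmod (n m : ℕ) :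
    (piAntidiag (univ : Finset (ZMod (n + 1))) m).card = (n + m).choose n := by
  rw [← map_sym_eq_piAntidiag, card_map, sym_univ, card_univ, Sym.card_sym_eq_multichoose,
    ZMod.card, Nat.multichoose_eq, show n + 1 + m - 1 = n + m by omega, Nat.choose_symm_add]

/-- The number of weak compositions of `n` into `n + 1` parts bounded below by given numbers. -/
lemma card_piAntidiag_filter_ge {n : ℕ} (hn : 1 ≤ n) (f : ZMod (n + 1) → ℕ) :
    ((piAntidiag univ n).filter fun y : ZMod (n + 1) → ℕ => ∀ a, f a ≤ y a).card =
      (2 * n - ∑ a, f a).choose n := by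
  by_cases hf : ∑ a, f a ≤ n
  · rw [show 2 * n - ∑ a, f a = n + (n - ∑ a, f a) by omega, ← card_piAntidiag_univ_zmod]
    refine card_nbij' (fun y a => y a - f a) (fun y a => y a + f a) ?_ ?_ ?_ ?_
    · intro y hy
      obtain ⟨hy, hfy⟩ := mem_filter.1 (mem_coe.1 hy)
      refine mem_coe.2 (mem_piAntidiag.2 ⟨?_, fun _ _ => mem_univ _⟩)
      have h1 : ∑ a, (y a - f a) + ∑ a, f a = ∑ a, y a := by
        rw [← sum_add_distrib]
        exact sum_congr rfl fun a _ => Nat.sub_add_cancel (hfy a)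
      have h2 : ∑ a, y a = n := (mem_piAntidiag.1 hy).1
      change ∑ a, (y a - f a) = _
      omega
    · intro y hy
      have h2 : ∑ a, y a = n - ∑ a, f a := (mem_piAntidiag.1 (mem_coe.1 hy)).1
      refine mem_coe.2 (mem_filter.2 ⟨mem_piAntidiag.2 ⟨?_, fun _ _ => mem_univ _⟩,
        fun a => Nat.le_add_left _ _⟩)
      rw [sum_add_distrib]
      omega
    · intro y hy
      have hfy := (mem_filter.1 (mem_coe.1 hy)).2
      exact funext fun a => Nat.sub_add_cancel (hfy a)
    · intro y _
      exact funext fun a => Nat.add_sub_cancel _ _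
  · rw [Nat.choose_eq_zero_of_lt (by omega), card_eq_zero, filter_eq_empty_iff]
    intro y hy hfy
    have h2 : ∑ a, y a = n := (mem_piAntidiag.1 hy).1
    have := sum_le_sum fun a (_ : a ∈ univ) => hfy a
    omega

lemma card_piAntidiag_filter_le_apply {n : ℕ} (hn : 1 ≤ n) (k : ℕ) (a : ZMod (n + 1)) :
    ((piAntidiag univ n).filter fun y : ZMod (n + 1) → ℕ => k ≤ y a).card =
      (2 * n - k).choose n := by
  have := card_piAntidiag_filter_ge hn (Pi.single a k)
  rw [sum_pi_single', if_pos (mem_univ _)] at this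
  rw [← this]
  congr 1
  refine filter_congr fun y _ => ⟨fun h c => ?_, fun h => by simpa using h a⟩
  obtain rfl | hc := eq_or_ne c a
  · simpa using h
  · simp [Pi.single_eq_of_ne hc]

lemma card_piAntidiag_filter_le_apply_pair {n : ℕ} (hn : 1 ≤ n) (k : ℕ) {a b : ZMod (n + 1)}
    (hab : a ≠ b) :
    ((piAntidiag univ n).filter fun y : ZMod (n + 1) → ℕ => k ≤ y a ∧ k ≤ y b).card =
      (2 * n - 2 * k).choose n := by
  have := card_piAntidiag_filter_ge hn (Pi.single a k + Pi.single b k)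
  simp only [Pi.add_apply] at this
  rw [sum_add_distrib, sum_pi_single', sum_pi_single', if_pos (mem_univ _), if_pos (mem_univ _),
    ← two_mul] at this
  rw [← this]
  congr 1
  refine filter_congr fun y _ => ⟨fun h c => ?_, fun h => ⟨?_, ?_⟩⟩
  · obtain rfl | hca := eq_or_ne c a
    · simpa [Pi.single_eq_of_ne hab] using h.1
    · obtain rfl | hcb := eq_or_ne c b
      · simpa [Pi.single_eq_of_ne hca] using h.2
      · simp [Pi.single_eq_of_ne hca, Pi.single_eq_of_ne hcb]
  · simpa [Pi.single_eq_of_ne hab] using h a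
  · simpa [Pi.single_eq_of_ne hab.symm] using h b

lemma two_pow_mul_choose_le {n : ℕ} (hn : 1 ≤ n) (k : ℕ) :
    2 ^ k * (2 * n - k).choose n ≤ (2 * n).choose n := by
  induction k with
  | zero => simp
  | succ k ih =>
    refine le_trans ?_ ih
    rw [pow_succ, mul_assoc]
    refine Nat.mul_le_mul_left _ ?_
    by_cases hk : k < 2 * n
    · obtain ⟨m, hm⟩ : ∃ m, 2 * n - k = m + 1 := ⟨2 * n - k - 1, by omega⟩
      rw [show 2 * n - (k + 1) = m by omega, hm]
      refine Nat.le_of_mul_le_mul_right ?_ (Nat.succ_pos m)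
      rw [mul_assoc, Nat.succ_eq_add_one, Nat.choose_mul_succ_eq, mul_left_comm]
      exact Nat.mul_le_mul_left _ (by omega)
    · rw [Nat.choose_eq_zero_of_lt (by omega)]
      simp

lemma choose_mul_choose_succ_le {n m m' : ℕ} (h : m ≤ m') :
    m.choose n * (m' + 1).choose n ≤ (m + 1).choose n * m'.choose n := by
  have h1 := Nat.choose_mul_succ_eq m n
  have h2 := Nat.choose_mul_succ_eq m' n
  refine Nat.le_of_mul_le_mul_right ?_ (Nat.mul_pos (Nat.succ_pos m) (Nat.succ_pos m'))
  have h3 : (m + 1 - n) * (m' + 1) ≤ (m + 1) * (m' + 1 - n) := by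
    by_cases hm : m + 1 ≤ n
    · rw [Nat.sub_eq_zero_of_le hm, zero_mul]
      exact Nat.zero_le _
    · zify [show n ≤ m + 1 by omega, show n ≤ m' + 1 by omega]
      have : (n : ℤ) * m ≤ n * m' := by gcongr
      linarith
  calc m.choose n * (m' + 1).choose n * ((m + 1) * (m' + 1))
      = (m.choose n * (m + 1)) * (m' + 1).choose n * (m' + 1) := by ring
    _ = (m + 1).choose n * (m' + 1).choose n * ((m + 1 - n) * (m' + 1)) := by rw [h1]; ring
    _ ≤ (m + 1).choose n * (m' + 1).choose n * ((m + 1) * (m' + 1 - n)) :=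
        Nat.mul_le_mul_left _ h3
    _ = (m + 1).choose n * (m + 1) * ((m' + 1).choose n * (m' + 1 - n)) := by ring
    _ = (m + 1).choose n * m'.choose n * ((m + 1) * (m' + 1)) := by rw [← h2]; ring

lemma choose_mul_choose_add_le {n m m' : ℕ} (h : m ≤ m') (k : ℕ) :
    m.choose n * (m' + k).choose n ≤ (m + k).choose n * m'.choose n := by
  by_cases hm' : m'.choose n = 0
  · rw [Nat.choose_eq_zero_of_lt ((Nat.choose_eq_zero_iff.1 hm').trans_le' h)]
    simp
  induction k with
  | zero => simp
  | succ k ih =>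
    by_cases hmk : (m + k).choose n = 0
    · rw [Nat.choose_eq_zero_of_lt (lt_of_le_of_lt (Nat.le_add_right m k)
        (Nat.choose_eq_zero_iff.1 hmk))]
      simp
    have hpos : 0 < (m' + k).choose n := Nat.choose_pos <|
      (not_lt.1 fun hlt => hm' (Nat.choose_eq_zero_of_lt hlt)).trans (Nat.le_add_right _ _)
    have hstep := choose_mul_choose_succ_le (n := n) (Nat.add_le_add_right h k)
    refine Nat.le_of_mul_le_mul_right ?_ (Nat.mul_pos (Nat.pos_of_ne_zero hmk) hpos)
    calc m.choose n * (m' + k + 1).choose n * ((m + k).choose n * (m' + k).choose n)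
        = (m.choose n * (m' + k).choose n) * ((m + k).choose n * (m' + k + 1).choose n) := by ring
      _ ≤ ((m + k).choose n * m'.choose n) * ((m + k + 1).choose n * (m' + k).choose n) :=
          Nat.mul_le_mul ih hstep
      _ = (m + k + 1).choose n * m'.choose n * ((m + k).choose n * (m' + k).choose n) := by ring

lemma pow_mul_choose_le {n k j : ℕ} (hk : k ≤ n) (hj : j ≤ k) :
    (n - k) ^ j * (2 * n).choose n ≤ (2 * n) ^ j * (2 * n - j).choose n := by
  induction j with
  | zero => simp
  | succ j ih =>
    obtain ⟨m, hm⟩ : ∃ m, 2 * n - j = m + 1 := ⟨2 * n - j - 1, by omega⟩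
    have h1 := Nat.choose_mul_succ_eq m n
    have ih := ih (by omega)
    rw [hm] at ih
    rw [show 2 * n - (j + 1) = m by omega]
    calc (n - k) ^ (j + 1) * (2 * n).choose n
        = (n - k) * ((n - k) ^ j * (2 * n).choose n) := by ring
      _ ≤ (n - k) * ((2 * n) ^ j * (m + 1).choose n) := Nat.mul_le_mul_left _ ih
      _ = (2 * n) ^ j * ((m + 1).choose n * (n - k)) := by ring
      _ ≤ (2 * n) ^ j * ((m + 1).choose n * (m + 1 - n)) := by
          refine Nat.mul_le_mul_left _ (Nat.mul_le_mul_left _ (by omega))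
      _ = (2 * n) ^ j * (m.choose n * (m + 1)) := by rw [h1]
      _ ≤ (2 * n) ^ j * (m.choose n * (2 * n)) := by
          refine Nat.mul_le_mul_left _ (Nat.mul_le_mul_left _ (by omega))
      _ = (2 * n) ^ (j + 1) * m.choose n := by ring

lemma choose_le_two_pow_mul {n k : ℕ} (hn : 1 ≤ n) (hk : 2 * k ^ 2 ≤ n) :
    ((2 * n).choose n : ℝ) ≤ 2 ^ (k + 1) * ((2 * n - k).choose n : ℝ) := by
  have hkn : k ≤ n := by nlinarith
  have hn0 : (0 : ℝ) < n := by exact_mod_cast hn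
  have hkn' : (k : ℝ) ≤ n := by exact_mod_cast hkn
  have hk' : 2 * (k : ℝ) ^ 2 ≤ n := by exact_mod_cast hk
  have hbern := one_add_mul_le_pow (a := -((k : ℝ) / n))
    (by have := (div_le_one hn0).2 hkn'; linarith) k
  have hhalf : (1 / 2 : ℝ) ≤ 1 + k * -((k : ℝ) / n) := by
    have : (k : ℝ) * (k / n) ≤ 1 / 2 := by
      rw [← mul_div_assoc, div_le_iff₀ hn0]
      nlinarith
    linarith
  have hpow : (n : ℝ) ^ k ≤ 2 * ((n : ℝ) - k) ^ k := by
    have h1 : (n : ℝ) - k = n * (1 + -((k : ℝ) / n)) := by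
      field_simp
      ring
    rw [h1, mul_pow]
    have := pow_pos hn0 k
    nlinarith
  have hmain : ((n : ℝ) - k) ^ k * ((2 * n).choose n : ℝ) ≤
      (2 * n) ^ k * ((2 * n - k).choose n : ℝ) := by
    have := pow_mul_choose_le hkn le_rfl
    rw [← Nat.cast_sub hkn]
    exact_mod_cast this
  refine le_of_mul_le_mul_left ?_ (pow_pos hn0 k)
  calc (n : ℝ) ^ k * ((2 * n).choose n : ℝ)
      ≤ 2 * ((n : ℝ) - k) ^ k * ((2 * n).choose n : ℝ) := by gcongr
    _ = 2 * (((n : ℝ) - k) ^ k * ((2 * n).choose n : ℝ)) := by ring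
    _ ≤ 2 * ((2 * n) ^ k * ((2 * n - k).choose n : ℝ)) := by gcongr
    _ = (n : ℝ) ^ k * (2 ^ (k + 1) * ((2 * n - k).choose n : ℝ)) := by
        rw [mul_pow]
        ring

/-- First moment bound for the largest part of a weak composition. -/
lemma card_filter_le_sup_le {n : ℕ} (hn : 1 ≤ n) {k : ℕ} (hk : 1 ≤ k) :
    ((piAntidiag univ n).filter fun y : ZMod (n + 1) → ℕ => k ≤ univ.sup y).card ≤
      (n + 1) * (2 * n - k).choose n := by
  have hsub : ((piAntidiag univ n).filter fun y : ZMod (n + 1) → ℕ => k ≤ univ.sup y) ⊆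
      univ.biUnion fun a => (piAntidiag univ n).filter fun y : ZMod (n + 1) → ℕ => k ≤ y a := by
    intro y hy
    obtain ⟨hy, hky⟩ := mem_filter.1 hy
    obtain ⟨a, -, ha⟩ := (Finset.le_sup_iff (Nat.lt_of_lt_of_le Nat.zero_lt_one hk)).1 hky
    exact mem_biUnion.2 ⟨a, mem_univ _, mem_filter.2 ⟨hy, ha⟩⟩
  refine (card_le_card hsub).trans (card_biUnion_le.trans ?_)
  rw [sum_congr rfl fun a _ => card_piAntidiag_filter_le_apply hn k a]
  simp [ZMod.card]

/-- Second moment bound for the largest part of a weak composition. -/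
lemma card_filter_sup_lt_mul_le {n : ℕ} (hn : 1 ≤ n) {k : ℕ} (hk : k ≤ n) :
    (((piAntidiag univ n).filter fun y : ZMod (n + 1) → ℕ => univ.sup y < k).card : ℝ) *
      ((n + 1) * ((2 * n - k).choose n : ℝ)) ≤ ((2 * n).choose n : ℝ) ^ 2 := by
  set Y : Finset (ZMod (n + 1) → ℕ) := piAntidiag univ n with hY
  set c₀ : ℝ := ((2 * n).choose n : ℝ) with hc₀
  set c₁ : ℝ := ((2 * n - k).choose n : ℝ) with hc₁
  set c₂ : ℝ := ((2 * n - 2 * k).choose n : ℝ) with hc₂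
  set χ : (ZMod (n + 1) → ℕ) → ZMod (n + 1) → ℝ := fun y a => if k ≤ y a then 1 else 0 with hχ
  have hcardY : (Y.card : ℝ) = c₀ := by
    rw [hY, card_piAntidiag_univ_zmod, ← two_mul]
  have hsum1 : ∀ a, ∑ y ∈ Y, χ y a = c₁ := by
    intro a
    simp only [hχ]
    rw [sum_boole, card_piAntidiag_filter_le_apply hn]
  have hsum2 : ∀ a b, ∑ y ∈ Y, χ y a * χ y b = c₂ + if a = b then c₁ - c₂ else 0 := by
    intro a b
    have hmul : ∀ y, χ y a * χ y b = if k ≤ y a ∧ k ≤ y b then 1 else 0 := by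
      intro y
      simp only [hχ]
      split_ifs <;> simp_all
    simp only [hmul]
    rw [sum_boole]
    split_ifs with hab
    · subst hab
      simp only [and_self]
      rw [card_piAntidiag_filter_le_apply hn]
      ring
    · rw [card_piAntidiag_filter_le_apply_pair hn k hab, add_zero]
  have hfirst : ∑ y ∈ Y, ∑ a, χ y a = (n + 1) * c₁ := by
    rw [sum_comm, sum_congr rfl fun a _ => hsum1 a]
    simp [ZMod.card]
  have hsecond : ∑ y ∈ Y, (∑ a, χ y a) ^ 2 = (n + 1) * c₁ + (n + 1) * n * c₂ := by
    have : ∀ y, (∑ a, χ y a) ^ 2 = ∑ a, ∑ b, χ y a * χ y b := by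
      intro y
      rw [sq, sum_mul_sum]
    simp only [this]
    rw [sum_comm]
    have : ∀ a, ∑ y ∈ Y, ∑ b, χ y a * χ y b = c₁ + n * c₂ := by
      intro a
      rw [sum_comm, sum_congr rfl fun b _ => hsum2 a b, sum_add_distrib, sum_ite_eq,
        if_pos (mem_univ _)]
      simp [ZMod.card]
      ring
    rw [sum_congr rfl fun a _ => this a]
    simp [ZMod.card]
    ring
  have hvar : ∑ y ∈ Y, (c₀ * ∑ a, χ y a - (n + 1) * c₁) ^ 2 =
      c₀ ^ 2 * ((n + 1) * c₁ + (n + 1) * n * c₂) - c₀ * ((n + 1) * c₁) ^ 2 := by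
    have : ∀ y, (c₀ * ∑ a, χ y a - (n + 1) * c₁) ^ 2 = c₀ ^ 2 * (∑ a, χ y a) ^ 2 -
        2 * c₀ * ((n + 1) * c₁) * (∑ a, χ y a) + ((n + 1) * c₁) ^ 2 := fun y => by ring
    simp only [this]
    rw [sum_add_distrib, sum_sub_distrib, ← mul_sum, ← mul_sum, hfirst, hsecond, sum_const,
      nsmul_eq_mul, hcardY]
    ring
  have hlower : ((Y.filter fun y => univ.sup y < k).card : ℝ) * ((n + 1) * c₁) ^ 2 ≤
      ∑ y ∈ Y, (c₀ * ∑ a, χ y a - (n + 1) * c₁) ^ 2 := by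
    rw [← nsmul_eq_mul, ← sum_const]
    refine le_trans (le_of_eq (sum_congr rfl fun y hy => ?_))
      (sum_le_sum_of_subset_of_nonneg (filter_subset _ _) fun _ _ _ => sq_nonneg _)
    have hy := (mem_filter.1 hy).2
    have : ∑ a, χ y a = 0 := by
      refine sum_eq_zero fun a _ => if_neg (not_le.2 ?_)
      exact (le_sup (f := y) (mem_univ a)).trans_lt hy
    rw [this]
    ring
  have hconc : c₂ * c₀ ≤ c₁ * c₁ := by
    have := choose_mul_choose_add_le (n := n) (show 2 * n - 2 * k ≤ 2 * n - k by omega) k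
    rw [show 2 * n - k + k = 2 * n by omega, show 2 * n - 2 * k + k = 2 * n - k by omega] at this
    rw [hc₀, hc₁, hc₂]
    exact_mod_cast this
  have hc₁pos : 0 < c₁ := by
    have : 0 < (2 * n - k).choose n := Nat.choose_pos (by omega)
    rw [hc₁]
    exact_mod_cast this
  have hc₀pos : 0 ≤ c₀ := Nat.cast_nonneg _
  have hn0 : (0 : ℝ) ≤ n := Nat.cast_nonneg _
  have hNpos : 0 < ((n : ℝ) + 1) * c₁ := by positivity
  refine le_of_mul_le_mul_right ?_ hNpos
  have h1 : c₀ * (n + 1) * n * (c₂ * c₀) ≤ c₀ * (n + 1) * n * (c₁ * c₁) := by gcongr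
  have h2 : 0 ≤ c₀ * (n + 1) * (c₁ * c₁) := by positivity
  rw [hvar] at hlower
  nlinarith

lemma card_ncPartitions_pos (n : ℕ) : 0 < (ncPartitions n).card := by
  have h := card_filter_ncPartitions n fun _ => True
  simp only [filter_true, card_piAntidiag_univ_zmod] at h
  have : 0 < (n + n).choose n := Nat.choose_pos (by omega)
  exact Nat.pos_of_ne_zero fun h0 => by simp [h0] at h; omega

lemma succ_mul_card_ncPartitions (n : ℕ) :
    (n + 1) * (ncPartitions n).card = (2 * n).choose n := by
  have h := card_filter_ncPartitions n fun _ => True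
  simpa only [filter_true, card_piAntidiag_univ_zmod, ← two_mul] using h

/-- Upper tail bound for the size of the largest block. -/
theorem card_filter_le_sup_card_div_le {n k : ℕ} (hn : 1 ≤ n) (hk : 1 ≤ k) :
    (((ncPartitions n).filter fun P => k ≤ P.sup card).card : ℝ) / ((ncPartitions n).card : ℝ) ≤
      (n + 1) / 2 ^ k := by
  have h1 : (n + 1) * ((ncPartitions n).filter fun P => k ≤ P.sup card).card =
      ((piAntidiag univ n).filter fun y : ZMod (n + 1) → ℕ => k ≤ univ.sup y).card := by
    convert card_filter_ncPartitions n fun m => k ≤ m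
  have h2 := card_filter_le_sup_le hn hk
  have h3 := two_pow_mul_choose_le hn k
  have h4 := succ_mul_card_ncPartitions n
  have h5 : (0 : ℝ) < (ncPartitions n).card := by exact_mod_cast card_ncPartitions_pos n
  rw [div_le_div_iff₀ h5 (by positivity)]
  have h6 : ((ncPartitions n).filter fun P => k ≤ P.sup card).card * 2 ^ k ≤
      (n + 1) * (ncPartitions n).card := by
    rw [h4]
    refine le_trans ?_ h3
    rw [mul_comm]
    refine Nat.mul_le_mul_left _ (Nat.le_of_mul_le_mul_left ?_ (Nat.succ_pos n))
    exact h1.trans_le h2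
  exact_mod_cast h6

/-- Lower tail bound for the size of the largest block. -/
theorem card_filter_sup_card_lt_div_le {n k : ℕ} (hn : 1 ≤ n) (hk : 2 * k ^ 2 ≤ n) :
    (((ncPartitions n).filter fun P => P.sup card < k).card : ℝ) / ((ncPartitions n).card : ℝ) ≤
      2 ^ (k + 1) / (n + 1) := by
  have hkn : k ≤ n := by nlinarith
  have h0 : (n + 1) * ((ncPartitions n).filter fun P => P.sup card < k).card =
      ((piAntidiag univ n).filter fun y : ZMod (n + 1) → ℕ => univ.sup y < k).card := by
    convert card_filter_ncPartitions n fun m => m < k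
  have h1 : ((n : ℝ) + 1) * ((ncPartitions n).filter fun P => P.sup card < k).card =
      ((piAntidiag univ n).filter fun y : ZMod (n + 1) → ℕ => univ.sup y < k).card := by
    exact_mod_cast h0
  have h2 := card_filter_sup_lt_mul_le hn hkn
  have h3 := choose_le_two_pow_mul hn hk
  have h4 : ((n : ℝ) + 1) * (ncPartitions n).card = ((2 * n).choose n : ℝ) := by
    exact_mod_cast succ_mul_card_ncPartitions n
  have h5 : (0 : ℝ) < (ncPartitions n).card := by exact_mod_cast card_ncPartitions_pos n
  have hc₁ : (0 : ℝ) < ((2 * n - k).choose n : ℝ) := by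
    exact_mod_cast Nat.choose_pos (show n ≤ 2 * n - k by omega)
  have hn0 : (0 : ℝ) < (n : ℝ) + 1 := by positivity
  rw [← h1] at h2
  rw [div_le_div_iff₀ h5 hn0]
  refine le_of_mul_le_mul_right ?_ (mul_pos hn0 hc₁)
  calc _ ≤ ((2 * n).choose n : ℝ) ^ 2 := by linarith
    _ = ((2 * n).choose n : ℝ) * ((2 * n).choose n : ℝ) := sq _
    _ ≤ ((2 * n).choose n : ℝ) * (2 ^ (k + 1) * ((2 * n - k).choose n : ℝ)) := by gcongr
    _ = _ := by
      rw [← h4]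
      ring

lemma eventually_two_mul_logb_add_one_sq_le :
    ∀ᶠ n : ℕ in atTop, 2 * (Real.logb 2 (n : ℝ) + 1) ^ 2 ≤ n := by
  have hlog : Tendsto (fun n : ℕ => Real.log (n : ℝ)) atTop atTop :=
    Real.tendsto_log_atTop.comp tendsto_natCast_atTop_atTop
  have hsmall : ∀ᶠ n : ℕ in atTop, ‖Real.log (n : ℝ) ^ 2‖ ≤ (1 / 32) * ‖(n : ℝ)‖ :=
    tendsto_natCast_atTop_atTop.eventually
      ((Real.isLittleO_pow_log_id_atTop (n := 2)).bound (by norm_num : (0 : ℝ) < 1 / 32))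
  filter_upwards [hlog.eventually_ge_atTop 1, hsmall] with n h1 h2
  rw [Real.norm_of_nonneg (sq_nonneg _), Real.norm_of_nonneg (Nat.cast_nonneg n)] at h2
  have h3 := Real.log_two_gt_d9
  have h4 : Real.logb 2 (n : ℝ) ≤ 2 * Real.log n := by
    rw [Real.logb, div_le_iff₀ (by linarith)]
    nlinarith
  have h5 : 0 ≤ Real.logb 2 (n : ℝ) := div_nonneg (by linarith) (by linarith)
  have h6 : (Real.logb 2 (n : ℝ) + 1) ^ 2 ≤ (3 * Real.log n) ^ 2 := by
    gcongr
    linarith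
  nlinarith

/-- Let `L_n` be the size of the largest block of a uniformly random non-crossing
partition of `{1, …, n}`.  Then `L_n / log₂ n → 1` in probability: for every `ε > 0`,
`P(|L_n / log₂ n - 1| > ε) → 0` as `n → ∞`. -/
theorem largest_block_log2_in_probability :
    ∀ ε : ℝ, 0 < ε →
      Filter.Tendsto (fun n : ℕ =>
          (((ncPartitions n).filter (fun P =>
              ε < |((P.sup Finset.card : ℕ) : ℝ) / Real.logb 2 (n : ℝ) - 1|)).card : ℝ) /
            ((ncPartitions n).card : ℝ))
        Filter.atTop (nhds 0) := by
  intro ε hε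
  set θ : ℝ := max (1 - ε) 0 with hθ
  have hθ0 : 0 ≤ θ := le_max_right _ _
  have hθ1 : θ < 1 := max_lt (by linarith) one_pos
  have hlim : Tendsto (fun n : ℕ => 2 * (n : ℝ) ^ (-ε) + 4 * (n : ℝ) ^ (-(1 - θ))) atTop
      (nhds 0) := by
    have h1 := ((tendsto_rpow_neg_atTop hε).comp tendsto_natCast_atTop_atTop).const_mul (2 : ℝ)
    have h2 := ((tendsto_rpow_neg_atTop (sub_pos.2 hθ1)).comp
      tendsto_natCast_atTop_atTop).const_mul (4 : ℝ)
    simpa using h1.add h2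
  refine squeeze_zero' (Eventually.of_forall fun n => by positivity) ?_ hlim
  filter_upwards [eventually_ge_atTop 2, eventually_two_mul_logb_add_one_sq_le] with n hn hsmall
  have hn0 : (0 : ℝ) < n := by exact_mod_cast (by omega : 0 < n)
  have hn1 : (1 : ℝ) ≤ n := by exact_mod_cast (by omega : 1 ≤ n)
  have hl : 0 < Real.logb 2 (n : ℝ) :=
    Real.logb_pos one_lt_two (by exact_mod_cast (by omega : 1 < n))
  set l := Real.logb 2 (n : ℝ) with hldef
  have hpow : ∀ s : ℝ, (2 : ℝ) ^ (s * l) = (n : ℝ) ^ s := by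
    intro s
    rw [mul_comm, Real.rpow_mul two_pos.le, hldef,
      Real.rpow_logb two_pos (by norm_num) hn0]
  have hcard : (0 : ℝ) < (ncPartitions n).card := by exact_mod_cast card_ncPartitions_pos n
  set k₁ := ⌈(1 + ε) * l⌉₊ with hk₁
  set k₂ := ⌈θ * l⌉₊ with hk₂
  have hk₁pos : 1 ≤ k₁ := Nat.ceil_pos.2 (by positivity)
  have hk₂le : (k₂ : ℝ) ≤ θ * l + 1 := (Nat.ceil_lt_add_one (by positivity)).le
  have hk₂sq : 2 * k₂ ^ 2 ≤ n := by
    have h1 : (k₂ : ℝ) ^ 2 ≤ (l + 1) ^ 2 := by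
      gcongr
      nlinarith
    have h2 : 2 * (k₂ : ℝ) ^ 2 ≤ n := by linarith
    exact_mod_cast h2
  have hsub : (ncPartitions n).filter (fun P =>
      ε < |((P.sup Finset.card : ℕ) : ℝ) / l - 1|) ⊆
      (ncPartitions n).filter (fun P => k₁ ≤ P.sup card) ∪
        (ncPartitions n).filter (fun P => P.sup card < k₂) := by
    intro P hP
    obtain ⟨hP, hdev⟩ := mem_filter.1 hP
    rw [mem_union, mem_filter, mem_filter]
    obtain h | h := lt_abs.1 hdev
    · refine Or.inl ⟨hP, Nat.ceil_le.2 ?_⟩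
      rw [← le_div_iff₀ hl]
      linarith
    · refine Or.inr ⟨hP, Nat.lt_ceil.2 ?_⟩
      rw [← div_lt_iff₀ hl]
      exact lt_of_lt_of_le (by linarith) (le_max_left _ _)
  have hupper : ((n : ℝ) + 1) / 2 ^ k₁ ≤ 2 * (n : ℝ) ^ (-ε) := by
    have h1 : (n : ℝ) ^ (1 + ε) ≤ 2 ^ k₁ := by
      rw [← hpow, ← Real.rpow_natCast]
      exact Real.rpow_le_rpow_of_exponent_le one_le_two (Nat.le_ceil _)
    rw [div_le_iff₀ (by positivity)]
    calc (n : ℝ) + 1 ≤ 2 * n := by linarith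
      _ = 2 * (n : ℝ) ^ (-ε) * (n : ℝ) ^ (1 + ε) := by
        rw [mul_assoc, ← Real.rpow_add hn0]
        simp
      _ ≤ 2 * (n : ℝ) ^ (-ε) * 2 ^ k₁ := by gcongr
  have hlower : (2 : ℝ) ^ (k₂ + 1) / (n + 1) ≤ 4 * (n : ℝ) ^ (-(1 - θ)) := by
    have h1 : (2 : ℝ) ^ k₂ ≤ 2 * (n : ℝ) ^ θ := by
      rw [← hpow, ← Real.rpow_natCast]
      refine (Real.rpow_le_rpow_of_exponent_le one_le_two hk₂le).trans_eq ?_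
      rw [Real.rpow_add two_pos, Real.rpow_one, mul_comm]
    rw [div_le_iff₀ (by positivity)]
    calc (2 : ℝ) ^ (k₂ + 1) = 2 * 2 ^ k₂ := by ring
      _ ≤ 2 * (2 * (n : ℝ) ^ θ) := by gcongr
      _ = 4 * (n : ℝ) ^ (-(1 - θ)) * n := by
        have : (n : ℝ) ^ θ = (n : ℝ) ^ (-(1 - θ)) * n := by
          rw [← Real.rpow_add_one hn0.ne']
          congr 1
          ring
        rw [this]
        ring
      _ ≤ 4 * (n : ℝ) ^ (-(1 - θ)) * (n + 1) := by gcongr; linarith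
  calc _ ≤ ((((ncPartitions n).filter (fun P => k₁ ≤ P.sup card)).card : ℝ) +
        ((ncPartitions n).filter (fun P => P.sup card < k₂)).card) / (ncPartitions n).card := by
        gcongr
        exact_mod_cast (card_le_card hsub).trans (card_union_le _ _)
    _ ≤ (n + 1) / 2 ^ k₁ + 2 ^ (k₂ + 1) / (n + 1) := by
        rw [add_div]
        exact add_le_add (card_filter_le_sup_card_div_le (by omega) hk₁pos)
          (card_filter_sup_card_lt_div_le (by omega) hk₂sq)
    _ ≤ _ := add_le_add hupper hlower
end
end

section
/- Let (k_n) be a sequence of positive integers with k_n ≤ n, k_n → ∞ and k_n/n → 0 as n → ∞. Then: (i) (C_{n−k_n}/C_n)² = 2^{−4k_n}·(1 + 3k_n/n + O((k_n/n)²)), i.e., there is a constant K such that for all sufficiently large n, |16^{k_n}·(C_{n−k_n}/C_n)² − 1 − 3k_n/n| ≤ K·(k_n/n)²; and (ii) (C_{n−2k_n}/C_n)² − (C_{n−k_n}/C_n)⁴ = 2^{−8k_n}·(3(k_n/n)² + O((k_n/n)³)), i.e., there is a constant K such that for all sufficiently large n, |2^{8k_n}·((C_{n−2k_n}/C_n)²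 − (C_{n−k_n}/C_n)⁴) − 3(k_n/n)²| ≤ K·(k_n/n)³. -/
open Finset Filter

/-- The normalised square `C_m² (m + 3/4)³ / 16^m`, which is nearly constant in `m`. -/
noncomputable def catalanNormSq (m : ℕ) : ℝ :=
  (catalan m : ℝ) ^ 2 * ((m : ℝ) + 3 / 4) ^ 3 / 16 ^ m

lemma catalan_pos (m : ℕ) : 0 < catalan m := by
  have h := succ_mul_catalan_eq_centralBinom m
  have h' := Nat.centralBinom_pos m
  rw [← h] at h'
  exact Nat.pos_of_mul_pos_left h'

lemma catalanNormSq_pos (m : ℕ) : 0 < catalanNormSq m := by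
  have := catalan_pos m
  unfold catalanNormSq
  positivity

lemma add_two_mul_catalan_succ (m : ℕ) :
    (m + 2) * catalan (m + 1) = 2 * (2 * m + 1) * catalan m := by
  have h := Nat.succ_mul_centralBinom_succ m
  rw [← succ_mul_catalan_eq_centralBinom, ← succ_mul_catalan_eq_centralBinom] at h
  apply Nat.eq_of_mul_eq_mul_left (Nat.succ_pos m)
  rw [Nat.succ_eq_add_one]
  linarith

lemma catalanNormSq_eq_succ_mul (m : ℕ) :
    catalanNormSq m = catalanNormSq (m + 1) *
      (((m : ℝ) + 2) ^ 2 * ((m : ℝ) + 3 / 4) ^ 3 /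
        (((m : ℝ) + 1 / 2) ^ 2 * ((m : ℝ) + 7 / 4) ^ 3)) := by
  have h : ((m : ℝ) + 2) * catalan (m + 1) = 2 * (2 * m + 1) * catalan m := by
    exact_mod_cast add_two_mul_catalan_succ m
  have hc : (catalan m : ℝ) = (m + 2) * catalan (m + 1) / (4 * (m + 1 / 2)) := by
    rw [h]
    field_simp
    ring
  unfold catalanNormSq
  rw [hc]
  have h' : ((m + 1 : ℕ) : ℝ) + 3 / 4 = m + 7 / 4 := by push_cast; ring
  rw [h', pow_succ]
  have h1 : (m : ℝ) + 7 / 4 ≠ 0 := by positivity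
  have h2 : (m : ℝ) + 1 / 2 ≠ 0 := by positivity
  generalize (m : ℝ) + 7 / 4 = a at *
  generalize (m : ℝ) + 1 / 2 = b at *
  field_simp
  ring

lemma catalanNormSq_succ_le (m : ℕ) : catalanNormSq (m + 1) ≤ catalanNormSq m := by
  rw [catalanNormSq_eq_succ_mul m]
  apply le_mul_of_one_le_right (catalanNormSq_pos _).le
  rw [one_le_div (by positivity)]
  have hm : (0 : ℝ) ≤ m := m.cast_nonneg
  nlinarith [mul_nonneg hm hm]

lemma catalanNormSq_le_succ_mul (m : ℕ) :
    catalanNormSq m ≤ catalanNormSq (m + 1) * (1 + 5 / (16 * ((m : ℝ) + 3 / 4) ^ 3)) := by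
  rw [catalanNormSq_eq_succ_mul m]
  apply mul_le_mul_of_nonneg_left _ (catalanNormSq_pos _).le
  have hm : (0 : ℝ) ≤ m := m.cast_nonneg
  rw [div_le_iff₀ (by positivity)]
  have key : ((m : ℝ) + 3 / 4) ^ 2 ≤ (m + 1 / 2) * (m + 7 / 4) := by nlinarith
  have key2 : ((m : ℝ) + 3 / 4) ^ 4 ≤ ((m + 1 / 2) * (m + 7 / 4)) ^ 2 := by
    have := pow_le_pow_left₀ (by positivity) key 2
    linarith
  have key3 : 5 / 16 * (((m : ℝ) + 3 / 4) * (m + 7 / 4)) ≤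
      5 / (16 * ((m : ℝ) + 3 / 4) ^ 3) * (((m : ℝ) + 1 / 2) ^ 2 * ((m : ℝ) + 7 / 4) ^ 3) := by
    rw [div_mul_eq_mul_div (5 : ℝ) (16 * _), le_div_iff₀ (by positivity)]
    have := mul_le_mul_of_nonneg_right key2 (show (0 : ℝ) ≤ m + 7 / 4 by positivity)
    linarith
  have key4 : ((m : ℝ) + 2) ^ 2 * ((m : ℝ) + 3 / 4) ^ 3 ≤
      ((m : ℝ) + 1 / 2) ^ 2 * ((m : ℝ) + 7 / 4) ^ 3 +
        5 / 16 * (((m : ℝ) + 3 / 4) * (m + 7 / 4)) := by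
    linarith
  linarith

lemma catalanNormSq_le_sub (n j : ℕ) : catalanNormSq n ≤ catalanNormSq (n - j) :=
  antitone_nat_of_succ_le catalanNormSq_succ_le (Nat.sub_le n j)

lemma catalanNormSq_sub_le (n : ℕ) (hn : 3 ≤ n) (j : ℕ) (hj : 2 * j ≤ n) :
    catalanNormSq (n - j) ≤ catalanNormSq n * (1 + 5 * j / (n : ℝ) ^ 3) := by
  have hn' : (3 : ℝ) ≤ n := by exact_mod_cast hn
  induction j with
  | zero => simp
  | succ j ih =>
    have hj' : 2 * (j + 1 : ℝ) ≤ n := by exact_mod_cast hj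
    have hstep := catalanNormSq_le_succ_mul (n - (j + 1))
    rw [show n - (j + 1) + 1 = n - j by omega] at hstep
    have hcast : ((n - (j + 1) : ℕ) : ℝ) = n - (j + 1) := by
      rw [Nat.cast_sub (by omega)]
      push_cast
      ring
    rw [hcast] at hstep
    set d : ℝ := 5 / (2 * (n : ℝ) ^ 3) with hd
    have hd0 : 0 ≤ d := by positivity
    have hle : 5 / (16 * ((n : ℝ) - (j + 1) + 3 / 4) ^ 3) ≤ d := by
      have h1 : ((n : ℝ) / 2) ^ 3 ≤ ((n : ℝ) - (j + 1) + 3 / 4) ^ 3 :=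
        pow_le_pow_left₀ (by positivity) (by linarith) 3
      apply div_le_div_of_nonneg_left (by norm_num) (by positivity)
      linarith
    have hjd : 2 * j * d ≤ 1 := by
      rw [hd, mul_div_assoc', div_le_one (by positivity)]
      nlinarith [mul_nonneg (show (0 : ℝ) ≤ n by positivity) (show (0 : ℝ) ≤ n - 3 by linarith),
        mul_nonneg (sq_nonneg (n : ℝ)) (show (0 : ℝ) ≤ n - 3 by linarith)]
    have e1 : 5 * (j : ℝ) / (n : ℝ) ^ 3 = 2 * j * d := by
      rw [hd]
      field_simp
    have e2 : 5 * ((j + 1 : ℕ) : ℝ) / (n : ℝ) ^ 3 = 2 * (j + 1) * d := by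
      rw [hd]
      push_cast
      field_simp
    rw [e2]
    have ih' := ih (by omega)
    rw [e1] at ih'
    calc catalanNormSq (n - (j + 1)) ≤ catalanNormSq (n - j) * (1 + d) :=
          hstep.trans (mul_le_mul_of_nonneg_left (by linarith) (catalanNormSq_pos _).le)
      _ ≤ catalanNormSq n * (1 + 2 * j * d) * (1 + d) :=
          mul_le_mul_of_nonneg_right ih' (by linarith)
      _ = catalanNormSq n * ((1 + 2 * j * d) * (1 + d)) := by ring
      _ ≤ catalanNormSq n * (1 + 2 * (j + 1) * d) := by
          apply mul_le_mul_of_nonneg_left _ (catalanNormSq_pos _).le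
          nlinarith [mul_le_mul_of_nonneg_right hjd hd0]

lemma exists_sq_catalan_ratio_eq (n : ℕ) (hn : 3 ≤ n) (j : ℕ) (hj : 2 * j ≤ n) :
    ∃ e : ℝ, 0 ≤ e ∧ e ≤ 5 * j / (n : ℝ) ^ 3 ∧
      (16 : ℝ) ^ j * ((catalan (n - j) : ℝ) / (catalan n : ℝ)) ^ 2 =
        ((1 - j / ((n : ℝ) + 3 / 4)) ^ 3)⁻¹ * (1 + e) := by
  have hp := catalanNormSq_pos n
  refine ⟨catalanNormSq (n - j) / catalanNormSq n - 1, ?_, ?_, ?_⟩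
  · rw [sub_nonneg, one_le_div hp]
    exact catalanNormSq_le_sub n j
  · rw [sub_le_iff_le_add, div_le_iff₀ hp]
    linarith [catalanNormSq_sub_le n hn j hj]
  · have hc : (catalan n : ℝ) ≠ 0 := by exact_mod_cast (catalan_pos n).ne'
    have hj' : 2 * (j : ℝ) ≤ n := by exact_mod_cast hj
    have hn' : (3 : ℝ) ≤ n := by exact_mod_cast hn
    have hS : (n : ℝ) + 3 / 4 ≠ 0 := by positivity
    have hSj : (n : ℝ) - j + 3 / 4 ≠ 0 := by linarith
    have hy : 1 - (j : ℝ) / ((n : ℝ) + 3 / 4) = (n - j + 3 / 4) / (n + 3 / 4) := by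
      rw [eq_div_iff hS, sub_mul, div_mul_cancel₀ _ hS]
      ring
    have h16 : (16 : ℝ) ^ n = 16 ^ (n - j) * 16 ^ j := by
      rw [← pow_add]
      congr 1
      omega
    rw [add_sub_cancel, hy]
    unfold catalanNormSq
    rw [Nat.cast_sub (by omega), h16]
    generalize (n : ℝ) - j + 3 / 4 = a at *
    generalize (n : ℝ) + 3 / 4 = b at *
    field_simp

lemma inv_one_sub_pow_three_le {y : ℝ} (hy : y ≤ 1 / 4) : ((1 - y) ^ 3)⁻¹ ≤ 3 := by
  have h : (3 / 4 : ℝ) ^ 3 ≤ (1 - y) ^ 3 := pow_le_pow_left₀ (by norm_num) (by linarith) 3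
  rw [inv_le_comm₀ (by linarith) (by norm_num)]
  norm_num at h ⊢
  linarith

lemma abs_inv_one_sub_pow_three_sub_le {y : ℝ} (h0 : 0 ≤ y) (hy : y ≤ 1 / 8) :
    |((1 - y) ^ 3)⁻¹ - 1 - 3 * y| ≤ 18 * y ^ 2 := by
  have hp : 0 < (1 - y) ^ 3 := pow_pos (by linarith) 3
  have hu := inv_one_sub_pow_three_le (y := y) (by linarith)
  have hu0 := inv_pos.2 hp
  have e : ((1 - y) ^ 3)⁻¹ - 1 - 3 * y =
      ((1 - y) ^ 3)⁻¹ * (y ^ 2 * (6 - 8 * y + 3 * y ^ 2)) := by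
    linear_combination (1 + 3 * y) * inv_mul_cancel₀ hp.ne'
  have h1 : 0 ≤ 6 - 8 * y + 3 * y ^ 2 := by nlinarith
  have h2 : 6 - 8 * y + 3 * y ^ 2 ≤ 6 := by nlinarith
  rw [e, abs_of_nonneg (by positivity)]
  calc _ ≤ 3 * (y ^ 2 * 6) := by gcongr
    _ = 18 * y ^ 2 := by ring

lemma abs_inv_pow_three_sub_inv_pow_six_sub_le {y : ℝ} (h0 : 0 ≤ y) (hy : y ≤ 1 / 8) :
    |((1 - 2 * y) ^ 3)⁻¹ - (((1 - y) ^ 3)⁻¹) ^ 2 - 3 * y ^ 2| ≤ 972 * y ^ 3 := by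
  have hA := inv_one_sub_pow_three_le (y := 2 * y) (by linarith)
  have hB := inv_one_sub_pow_three_le (y := y) (by linarith)
  have hp : 0 < (1 - 2 * y) ^ 3 := pow_pos (by linarith) 3
  have hq : 0 < (1 - y) ^ 3 := pow_pos (by linarith) 3
  have hp0 := inv_pos.2 hp
  have hq0 := inv_pos.2 hq
  have h1 : 1 - 6 * y ≤ (1 - 2 * y) ^ 3 := by
    have := one_add_mul_le_pow (a := -(2 * y)) (by linarith) 3
    norm_num at this
    rw [sub_eq_add_neg 1 (2 * y)]
    linarith
  have h2 : 1 - 6 * y ≤ ((1 - y) ^ 3) ^ 2 := by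
    have := one_add_mul_le_pow (a := -y) (by linarith) 6
    norm_num at this
    rw [← pow_mul, sub_eq_add_neg 1 y]
    norm_num
    linarith
  have h3 : (1 - 2 * y) ^ 3 ≤ 1 := pow_le_one₀ (by linarith) (by linarith)
  have h4 : ((1 - y) ^ 3) ^ 2 ≤ 1 :=
    pow_le_one₀ hq.le (pow_le_one₀ (by linarith) (by linarith))
  set M := (1 - 2 * y) ^ 3 * ((1 - y) ^ 3) ^ 2 with hM
  have hM1 : M ≤ 1 := mul_le_one₀ h3 (by positivity) h4
  have hM2 : 1 - 12 * y ≤ M := by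
    nlinarith [mul_nonneg (sub_nonneg.2 h3) (sub_nonneg.2 h4)]
  set Q := 3 * (1 - 2 * y) ^ 2 + 3 * y ^ 2 * (1 - 2 * y) + y ^ 4 with hQ
  have e : ((1 - 2 * y) ^ 3)⁻¹ - (((1 - y) ^ 3)⁻¹) ^ 2 - 3 * y ^ 2 =
      ((1 - 2 * y) ^ 3)⁻¹ * (((1 - y) ^ 3)⁻¹) ^ 2 * (y ^ 2 * (Q - 3 * M)) := by
    have hN : y ^ 2 * (Q - 3 * M) =
        ((1 - y) ^ 3) ^ 2 - (1 - 2 * y) ^ 3 - 3 * y ^ 2 * M := by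
      rw [hQ]
      ring
    rw [hN, hM]
    generalize (1 - 2 * y) ^ 3 = a at *
    generalize (1 - y) ^ 3 = b at *
    field_simp
  have hQ1 : Q ≤ 3 := by
    rw [hQ]
    nlinarith [pow_nonneg h0 2, pow_nonneg h0 3, mul_nonneg h0 (sub_nonneg.2 hy),
      mul_nonneg (pow_nonneg h0 2) (sub_nonneg.2 hy), mul_nonneg (pow_nonneg h0 3) (sub_nonneg.2 hy)]
  have hQ2 : 3 - 12 * y ≤ Q := by
    rw [hQ]
    nlinarith [pow_nonneg h0 2, pow_nonneg h0 4,
      mul_nonneg (pow_nonneg h0 2) (sub_nonneg.2 hy)]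
  have hb : |Q - 3 * M| ≤ 36 * y := abs_le.2 ⟨by linarith, by linarith⟩
  rw [e, abs_mul, abs_mul (y ^ 2), abs_of_nonneg (by positivity : (0 : ℝ) ≤ y ^ 2),
    abs_of_nonneg (by positivity : 0 ≤ ((1 - 2 * y) ^ 3)⁻¹ * (((1 - y) ^ 3)⁻¹) ^ 2)]
  calc _ ≤ 3 * 3 ^ 2 * (y ^ 2 * (36 * y)) := by gcongr
    _ = 972 * y ^ 3 := by ring

/-- Let `(k_n)` be a sequence of positive integers with `k_n ≤ n`, `k_n → ∞` and
`k_n/n → 0`.  Then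
(i) `(C_{n-k_n}/C_n)² = 2^{-4k_n}·(1 + 3k_n/n + O((k_n/n)²))`, and
(ii) `(C_{n-2k_n}/C_n)² - (C_{n-k_n}/C_n)⁴ = 2^{-8k_n}·(3(k_n/n)² + O((k_n/n)³))`. -/
theorem catalan_ratio_asymptotics (k : ℕ → ℕ)
    (hpos : ∀ n : ℕ, 1 ≤ n → 1 ≤ k n) (hle : ∀ n : ℕ, 1 ≤ n → k n ≤ n)
    (hinf : Filter.Tendsto k Filter.atTop Filter.atTop)
    (hsmall : Filter.Tendsto (fun n : ℕ => (k n : ℝ) / (n : ℝ))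
      Filter.atTop (nhds 0)) :
    (∃ K : ℝ, ∃ N₀ : ℕ, ∀ n : ℕ, N₀ ≤ n →
      |(16 : ℝ) ^ (k n) * ((catalan (n - k n) : ℝ) / (catalan n : ℝ)) ^ 2 -
          1 - 3 * (k n : ℝ) / (n : ℝ)|
        ≤ K * ((k n : ℝ) / (n : ℝ)) ^ 2) ∧
    (∃ K : ℝ, ∃ N₀ : ℕ, ∀ n : ℕ, N₀ ≤ n →
      |(2 : ℝ) ^ (8 * k n) *
          (((catalan (n - 2 * k n) : ℝ) / (catalan n : ℝ)) ^ 2 -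
            ((catalan (n - k n) : ℝ) / (catalan n : ℝ)) ^ 4) -
          3 * ((k n : ℝ) / (n : ℝ)) ^ 2|
        ≤ K * ((k n : ℝ) / (n : ℝ)) ^ 3) := by
  obtain ⟨N₁, hN₁⟩ := eventually_atTop.1 (hsmall.eventually_le_const
    (show (0 : ℝ) < 1 / 8 by norm_num))
  have basic : ∀ n : ℕ, max N₁ 3 ≤ n → ∃ y : ℝ, y = k n / ((n : ℝ) + 3 / 4) ∧ 3 ≤ n ∧
      4 * k n ≤ n ∧ 0 ≤ y ∧ y ≤ 1 / 8 ∧ y ≤ (k n : ℝ) / n ∧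
      (k n : ℝ) / n - y ≤ ((k n : ℝ) / n) ^ 2 ∧
      (k n : ℝ) / (n : ℝ) ^ 3 ≤ ((k n : ℝ) / n) ^ 3 := by
    intro n hn
    have hn3 : 3 ≤ n := (le_max_right _ _).trans hn
    have hx := hN₁ n ((le_max_left _ _).trans hn)
    have hk : (1 : ℝ) ≤ k n := by exact_mod_cast hpos n (by omega)
    have hn0 : (3 : ℝ) ≤ n := by exact_mod_cast hn3
    have hyx : (k n : ℝ) / ((n : ℝ) + 3 / 4) ≤ (k n : ℝ) / n :=
      div_le_div_of_nonneg_left (by positivity) (by linarith) (by linarith)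
    refine ⟨_, rfl, hn3, ?_, by positivity, hyx.trans hx, hyx, ?_, ?_⟩
    · rw [div_le_iff₀ (by linarith)] at hx
      have : (4 : ℝ) * k n ≤ n := by linarith
      exact_mod_cast this
    · rw [div_sub_div _ _ (by positivity) (by positivity), div_pow,
        div_le_div_iff₀ (by positivity) (by positivity)]
      have h1 : (k n : ℝ) ≤ (k n : ℝ) ^ 2 := by nlinarith
      have h2 : (k n : ℝ) * (3 / 4) * (n : ℝ) ^ 2 ≤ (k n : ℝ) ^ 2 * 1 * (n * (n + 3 / 4)) := by
        gcongr
        · norm_num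
        · nlinarith
      linarith
    · rw [div_pow]
      gcongr
      exact le_self_pow₀ hk (by norm_num)
  refine ⟨⟨36, max N₁ 3, fun n hn => ?_⟩, ⟨1200, max N₁ 3, fun n hn => ?_⟩⟩
  · obtain ⟨y, hy, hn3, h4, hy0, hy8, hyx, hxy, hk3⟩ := basic n hn
    obtain ⟨e, he0, he, heq⟩ := exists_sq_catalan_ratio_eq n hn3 (k n) (by omega)
    rw [← hy] at heq
    rw [heq, mul_div_assoc]
    rw [mul_div_assoc] at he
    have hx8 := hN₁ n ((le_max_left _ _).trans hn)
    set x : ℝ := (k n : ℝ) / n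
    have hU := abs_le.1 (abs_inv_one_sub_pow_three_sub_le hy0 hy8)
    have hu := inv_one_sub_pow_three_le (y := y) (by linarith)
    have hu0 : 0 < ((1 - y) ^ 3)⁻¹ := inv_pos.2 (pow_pos (by linarith) 3)
    set u := ((1 - y) ^ 3)⁻¹
    have hy2 : y ^ 2 ≤ x ^ 2 := pow_le_pow_left₀ hy0 hyx 2
    have hx3 : x ^ 3 ≤ 1 / 8 * x ^ 2 := by nlinarith [sq_nonneg x]
    have hue : u * e ≤ 3 * (5 * x ^ 3) := by
      gcongr
      linarith
    have hue0 : 0 ≤ u * e := by positivity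
    rw [abs_le]
    constructor <;> nlinarith
  · obtain ⟨y, hy, hn3, h4, hy0, hy8, hyx, hxy, hk3⟩ := basic n hn
    obtain ⟨e, he0, he, heq⟩ := exists_sq_catalan_ratio_eq n hn3 (k n) (by omega)
    obtain ⟨f, hf0, hf, hfeq⟩ := exists_sq_catalan_ratio_eq n hn3 (2 * k n) (by omega)
    have hy' : ((2 * k n : ℕ) : ℝ) / ((n : ℝ) + 3 / 4) = 2 * y := by
      rw [hy]
      push_cast
      ring
    have hf' : f ≤ 10 * ((k n : ℝ) / (n : ℝ) ^ 3) := by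
      refine hf.trans_eq ?_
      push_cast
      ring
    rw [← hy] at heq
    rw [hy'] at hfeq
    rw [mul_div_assoc] at he
    have hL : (2 : ℝ) ^ (8 * k n) *
          (((catalan (n - 2 * k n) : ℝ) / (catalan n : ℝ)) ^ 2 -
            ((catalan (n - k n) : ℝ) / (catalan n : ℝ)) ^ 4) =
        (16 : ℝ) ^ (2 * k n) * ((catalan (n - 2 * k n) : ℝ) / (catalan n : ℝ)) ^ 2 -
          ((16 : ℝ) ^ k n * ((catalan (n - k n) : ℝ) / (catalan n : ℝ)) ^ 2) ^ 2 := by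
      rw [show (2 : ℝ) ^ (8 * k n) = (16 ^ k n) ^ 2 by
        rw [← pow_mul, show (16 : ℝ) = 2 ^ 4 by norm_num, ← pow_mul]
        congr 1
        ring, mul_comm 2 (k n), pow_mul]
      ring
    rw [hL, heq, hfeq]
    have hx8 := hN₁ n ((le_max_left _ _).trans hn)
    set x : ℝ := (k n : ℝ) / n
    have hU := abs_le.1 (abs_inv_pow_three_sub_inv_pow_six_sub_le hy0 hy8)
    have hu := inv_one_sub_pow_three_le (y := y) (by linarith)
    have hu0 : 0 < ((1 - y) ^ 3)⁻¹ := inv_pos.2 (pow_pos (by linarith) 3)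
    have hv := inv_one_sub_pow_three_le (y := 2 * y) (by linarith)
    have hv0 : 0 < ((1 - 2 * y) ^ 3)⁻¹ := inv_pos.2 (pow_pos (by linarith) 3)
    set u := ((1 - y) ^ 3)⁻¹
    set v := ((1 - 2 * y) ^ 3)⁻¹
    have hx0 : 0 ≤ x := hy0.trans hyx
    have hy3 : y ^ 3 ≤ x ^ 3 := pow_le_pow_left₀ hy0 hyx 3
    have hy2 : y ^ 2 ≤ x ^ 2 := pow_le_pow_left₀ hy0 hyx 2
    have hxy2 : x ^ 2 - y ^ 2 ≤ 2 * x ^ 3 := by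
      nlinarith [mul_le_mul_of_nonneg_right hxy hx0, mul_le_mul_of_nonneg_right hxy hy0,
        mul_le_mul_of_nonneg_left hyx (sq_nonneg x)]
    have hx3 : x ^ 3 ≤ (1 / 8) ^ 3 := pow_le_pow_left₀ hx0 hx8 3
    have he1 : e ≤ 1 := by linarith
    have hvf : v * f ≤ 3 * (10 * x ^ 3) := by
      gcongr
      linarith
    have hvf0 : 0 ≤ v * f := by positivity
    have hue : u ^ 2 * (e * (2 + e)) ≤ 3 ^ 2 * (5 * x ^ 3 * (2 + 1)) := by
      gcongr
      linarith
    have hue0 : 0 ≤ u ^ 2 * (e * (2 + e)) := by positivity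
    have hsplit : v * (1 + f) - (u * (1 + e)) ^ 2 - 3 * x ^ 2 =
        (v - u ^ 2 - 3 * y ^ 2) + v * f - u ^ 2 * (e * (2 + e)) - 3 * (x ^ 2 - y ^ 2) := by
      ring
    have hx3' : 0 ≤ x ^ 3 := by positivity
    rw [hsplit, abs_le]
    constructor <;> linarith
end
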